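/- For every integer n ≥ 1, the 2×2 operator matrix Q_n with entries (Q_n)₁₁ = G_n(F_n+G_n)⁻¹, (Q_n)₁₂ = √(F_nG_n)(F_n+G_n)⁻¹𝔖ⁿ, (Q_n)₂₁ = √(f_n(ζ)g_n(ζ))(f_n(ζ)+g_n(ζ))⁻¹𝔖*ⁿ, (Q_n)₂₂ = f_n(ζ)(f_n(ζ)+g_n(ζ))⁻¹ is a self-adjoint idempotent in the algebra of 2×2 matrices over B(H ⊕ H): Q_n* = Q_n and Q_n² = Q_n. -/

import Mathlib

set_option synthInstance.maxHeartbeats 1000000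
set_option maxHeartbeats 1000000

section DiagonalOperators

variable {ι K : Type*} [NormedAddCommGroup K] [InnerProductSpace ℂ K]

/-- The operator `T` is diagonal in the Hilbert basis `b`, with real eigenvalues `d`. -/
def IsDiag (b : HilbertBasis ι ℂ K) (T : K →L[ℂ] K) (d : ι → ℝ) : Prop :=
  ∀ i, T (b i) = (d i : ℂ) • b i

lemma HilbertBasis.clm_ext (b : HilbertBasis ι ℂ K) {T U : K →L[ℂ] K}
    (h : ∀ i, T (b i) = U (b i)) : T = U := by
  refine ContinuousLinearMap.ext_on (s := Set.range b) ?_ ?_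
  · exact Submodule.dense_iff_topologicalClosure_eq_top.mpr b.dense_span
  · rintro _ ⟨i, rfl⟩
    exact h i

lemma HilbertBasis.eq_of_inner (b : HilbertBasis ι ℂ K) {v w : K}
    (h : ∀ i, inner ℂ (b i) v = inner ℂ (b i) w) : v = w := by
  apply b.repr.injective
  ext i
  simpa [b.repr_apply_apply] using h i

namespace IsDiag

variable {b : HilbertBasis ι ℂ K} {T U : K →L[ℂ] K} {c d : ι → ℝ}

lemma eq (hT : IsDiag b T d) (hU : IsDiag b U d) : T = U :=
  b.clm_ext fun i => by rw [hT i, hU i]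

lemma one : IsDiag b 1 (fun _ => 1) := fun i => by simp

lemma add (hT : IsDiag b T c) (hU : IsDiag b U d) : IsDiag b (T + U) (fun i => c i + d i) :=
  fun i => by simp [hT i, hU i, add_smul]

lemma sub (hT : IsDiag b T c) (hU : IsDiag b U d) : IsDiag b (T - U) (fun i => c i - d i) :=
  fun i => by simp [hT i, hU i, sub_smul]

lemma mul (hT : IsDiag b T c) (hU : IsDiag b U d) : IsDiag b (T * U) (fun i => c i * d i) :=
  fun i => by simp only [mul_apply_eq_comp, hU i, hT i, map_smul, smul_smul, Complex.ofReal_mul, mul_comm]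

lemma smul (r : ℝ) (hT : IsDiag b T d) : IsDiag b ((r : ℂ) • T) (fun i => r * d i) :=
  fun i => by simp only [smul_apply, hT i, smul_smul, Complex.ofReal_mul]

lemma congr (hT : IsDiag b T c) (h : ∀ i, c i = d i) : IsDiag b T d :=
  fun i => by rw [hT i, h i]

lemma list_prod {T : ℕ → K →L[ℂ] K} {d : ℕ → ι → ℝ} (h : ∀ k, IsDiag b (T k) (d k)) (n : ℕ) :
    IsDiag b ((List.range n).map T).prod (fun i => ∏ k ∈ Finset.range n, d k i) := by
  induction n with
  | zero => simpa using one
  | succ n ih =>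
    simp only [List.range_succ, List.map_append, List.prod_append, Finset.prod_range_succ]
    simpa using ih.mul (h n)

variable [CompleteSpace K]

lemma star_eq (hT : IsDiag b T d) : star T = T := by
  classical
  refine b.clm_ext fun i => b.eq_of_inner fun j => ?_
  rw [ContinuousLinearMap.star_eq_adjoint, ContinuousLinearMap.adjoint_inner_right, hT j, hT i,
    inner_smul_left, inner_smul_right, orthonormal_iff_ite.mp b.orthonormal]
  split_ifs with hij
  · simp [hij]
  · simp

lemma nonneg (hT : IsDiag b T d) (hd : ∀ i, 0 ≤ d i) : 0 ≤ T := by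
  rw [ContinuousLinearMap.nonneg_iff_isPositive,
    ContinuousLinearMap.isPositive_iff_complex]
  intro v
  have hsum := b.hasSum_inner_mul_inner (T v) v
  have hterm : ∀ i, inner ℂ (T v) (b i) * inner ℂ (b i) v =
      ((d i * ‖inner ℂ (b i) v‖ ^ 2 : ℝ) : ℂ) := by
    intro i
    have h1 : inner ℂ (T v) (b i) = inner ℂ v (T (b i)) := by
      conv_lhs => rw [← hT.star_eq, ContinuousLinearMap.star_eq_adjoint,
        ContinuousLinearMap.adjoint_inner_left]
    rw [h1, hT i, inner_smul_right, mul_assoc, ← inner_conj_symm v (b i), RCLike.conj_mul]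
    push_cast
    rfl
  simp only [hterm] at hsum
  have hre := Complex.hasSum_re hsum
  have him := Complex.hasSum_im hsum
  simp only [Complex.ofReal_re, Complex.ofReal_im] at hre him
  have h0 : (inner ℂ (T v) v).im = 0 := him.unique hasSum_zero
  refine ⟨?_, hre.nonneg fun i => mul_nonneg (hd i) (by positivity)⟩
  apply Complex.ext <;> simp [h0]

lemma isUnit (hT : IsDiag b T d) {r : ℝ} (hr : 0 < r) (hd : ∀ i, r ≤ d i) : IsUnit T := by
  have hD : IsDiag b ((r : ℂ) • (1 : K →L[ℂ] K)) (fun _ => r * 1) := one.smul r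
  have hle : (r : ℂ) • (1 : K →L[ℂ] K) ≤ T :=
    sub_nonneg.mp ((hT.sub hD).nonneg fun i => by simpa using hd i)
  refine CStarAlgebra.isUnit_of_le _ hle ?_
  rw [IsStrictlyPositive.iff_of_unital]
  refine ⟨hD.nonneg fun _ => by simpa using hr.le, ?_⟩
  have hr' : (r : ℂ) ≠ 0 := by exact_mod_cast hr.ne'
  exact (isUnit_one (M := K →L[ℂ] K)).smul (Units.mk0 (r : ℂ) hr')

omit [CompleteSpace K] in
lemma inverse (hT : IsDiag b T d) (hu : IsUnit T) (hd : ∀ i, d i ≠ 0) :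
    IsDiag b (Ring.inverse T) (fun i => (d i)⁻¹) := by
  intro i
  have h1 : Ring.inverse T (T (b i)) = b i := by
    rw [← mul_apply_eq_comp, Ring.inverse_mul_cancel _ hu,
      one_apply_eq_self]
  have hd' : (d i : ℂ) ≠ 0 := by exact_mod_cast hd i
  rw [hT i, map_smul] at h1
  conv_rhs => rw [← h1]
  rw [smul_smul, Complex.ofReal_inv, inv_mul_cancel₀ hd', one_smul]

end IsDiag

lemma ContinuousLinearMap.sqrt_apply_of_eigenvector [CompleteSpace K] {T : K →L[ℂ] K} (hT : 0 ≤ T)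
    {v : K} {d : ℝ} (hd : 0 ≤ d) (hv : T v = (d : ℂ) • v) :
    CFC.sqrt T v = ((√d : ℝ) : ℂ) • v := by
  set R := CFC.sqrt T
  have hR : R.IsPositive :=
    (ContinuousLinearMap.nonneg_iff_isPositive R).mp (CFC.sqrt_nonneg T)
  have hRR : ∀ w, R (R w) = T w := fun w => by
    rw [← mul_apply_eq_comp, CFC.sqrt_mul_sqrt_self T hT]
  have hdd : ((√d : ℝ) : ℂ) * ((√d : ℝ) : ℂ) = d := by
    exact_mod_cast Real.mul_self_sqrt hd
  rcases hd.eq_or_lt with rfl | hd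
  · have h0 : inner ℂ (R v) (R v) = 0 := by
      rw [← hR.isSelfAdjoint.adjoint_eq, ContinuousLinearMap.adjoint_inner_left,
        hR.isSelfAdjoint.adjoint_eq, hRR, hv]
      simp
    simpa using h0
  · set w := R v - ((√d : ℝ) : ℂ) • v with hw
    have hRw : R w = -((√d : ℝ) : ℂ) • w := by
      rw [hw, map_sub, map_smul, hRR, hv, ← hdd, smul_sub, smul_smul]
      module
    have hpos := hR.re_inner_nonneg_left w
    rw [hRw, inner_smul_left, inner_self_eq_norm_sq_to_K] at hpos
    have hre : RCLike.re ((starRingEnd ℂ) (-((√d : ℝ) : ℂ)) * ((‖w‖ : ℝ) : ℂ) ^ 2)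
        = -(√d * ‖w‖ ^ 2) := by
      rw [map_neg, Complex.conj_ofReal, ← Complex.ofReal_pow, ← Complex.ofReal_neg,
        ← Complex.ofReal_mul, neg_mul]
      exact Complex.ofReal_re _
    have hpos' : 0 ≤ -(√d * ‖w‖ ^ 2) := hre ▸ hpos
    have hs : 0 < √d := Real.sqrt_pos.mpr hd
    have hw0 : w = 0 := by
      by_contra hne
      have : 0 < √d * ‖w‖ ^ 2 := mul_pos hs (pow_pos (norm_pos_iff.mpr hne) 2)
      linarith
    exact sub_eq_zero.mp hw0

lemma IsDiag.sqrt [CompleteSpace K] {b : HilbertBasis ι ℂ K} {T : K →L[ℂ] K} {d : ι → ℝ}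
    (hT : IsDiag b T d) (hd : ∀ i, 0 ≤ d i) : IsDiag b (CFC.sqrt T) (fun i => √(d i)) :=
  fun i => ContinuousLinearMap.sqrt_apply_of_eigenvector (hT.nonneg hd) (hd i) (hT i)

end DiagonalOperators

lemma shifted_diag_projection {α K : Type*} [NormedAddCommGroup K] [InnerProductSpace ℂ K]
    [CompleteSpace K] {b : HilbertBasis (α × ℕ) ℂ K} {V X Y Y' W : K →L[ℂ] K} {n : ℕ}
    {x y : α × ℕ → ℝ} (hV : ∀ i m, V (b (i, m)) = b (i, m + n))
    (hX : IsDiag b X x) (hY : IsDiag b Y y)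
    (hY' : IsDiag b Y' (fun p => y (p.1, p.2 + n)))
    (hW : IsDiag b W (fun p => 1 - x (p.1, p.2 + n)))
    (hxy : ∀ p, y p * y p = x p * (1 - x p)) (hy : ∀ i m, m < n → y (i, m) = 0) :
    star !![X, Y * V; Y' * star V, W] = !![X, Y * V; Y' * star V, W] ∧
      !![X, Y * V; Y' * star V, W] * !![X, Y * V; Y' * star V, W] =
        !![X, Y * V; Y' * star V, W] := by
  classical
  have hYV : Y * V = V * Y' := b.clm_ext fun ⟨i, m⟩ => by
    simp [hV, hY (i, m + n), hY' (i, m)]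
  have hVY : star V * Y = Y' * star V := by
    simpa [hY.star_eq, hY'.star_eq] using congrArg star hYV
  have hXV : X * V = V * (1 - W) := b.clm_ext fun ⟨i, m⟩ => by
    simp [hV, hX (i, m + n), hW (i, m), sub_smul]
  have hWV : W * star V = star V * (1 - X) := by
    have h := congrArg star hXV
    simp only [star_mul, star_sub, star_one, hX.star_eq, hW.star_eq, sub_mul, one_mul] at h
    rw [mul_sub, mul_one, h, sub_sub_cancel]
  have hVV : star V * V = 1 := b.clm_ext fun ⟨i, m⟩ => b.eq_of_inner fun ⟨j, l⟩ => by
    rw [mul_apply_eq_comp, ContinuousLinearMap.star_eq_adjoint,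
      ContinuousLinearMap.adjoint_inner_right, hV, hV, one_apply_eq_self,
      orthonormal_iff_ite.mp b.orthonormal, orthonormal_iff_ite.mp b.orthonormal]
    simp
  have hP : V * star V * Y = Y := b.clm_ext fun ⟨i, m⟩ => by
    rw [mul_apply_eq_comp, hY (i, m), map_smul]
    rcases lt_or_ge m n with h | h
    · simp [hy i m h]
    · obtain ⟨l, rfl⟩ := Nat.exists_eq_add_of_le' h
      rw [← hV i l, ← mul_apply_eq_comp, mul_assoc, hVV, mul_one]
  have hP' : Y * (V * star V) = Y := by
    simpa [hY.star_eq, mul_assoc] using congrArg star hP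
  have hYY : Y * Y = X - X * X := (hY.mul hY).eq <|
    (hX.sub (hX.mul hX)).congr fun p => by rw [hxy]; ring
  have hYY' : Y' * Y' = W - W * W := (hY'.mul hY').eq <|
    (hW.sub (hW.mul hW)).congr fun p => by rw [hxy]; ring
  have hXY : X * Y = Y * X := (hX.mul hY).eq <| (hY.mul hX).congr fun p => mul_comm _ _
  have hWY : W * Y' = Y' * W := (hW.mul hY').eq <| (hY'.mul hW).congr fun p => mul_comm _ _
  constructor
  · refine Matrix.ext fun i j => ?_
    fin_cases i <;> fin_cases j
    · simpa [Matrix.star_apply] using hX.star_eq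
    · simp [Matrix.star_apply, hY'.star_eq, hYV]
    · simp [Matrix.star_apply, hY.star_eq, hVY]
    · simpa [Matrix.star_apply] using hW.star_eq
  · have h11 : X * X + Y * V * (Y' * star V) = X := by
      rw [← hVY, mul_assoc, ← mul_assoc V, hP, hYY, add_sub_cancel]
    have h12 : X * (Y * V) + Y * V * W = Y * V := by
      rw [← mul_assoc, hXY, mul_assoc, hXV, mul_assoc, mul_sub, mul_sub, mul_one, sub_add_cancel]
    have h21 : Y' * star V * X + W * (Y' * star V) = Y' * star V := by
      rw [← mul_assoc W, hWY, mul_assoc, mul_assoc Y' W, hWV, mul_sub, mul_sub, mul_one,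
        add_sub_cancel]
    have h22 : Y' * star V * (Y * V) + W * W = W := by
      rw [hYV, mul_assoc, ← mul_assoc (star V), hVV, one_mul, hYY', sub_add_cancel]
    rw [Matrix.mul_fin_two, h11, h12, h21, h22]

/-- The eigenvalues of `Z₋ ⊕ Z₊`. -/
noncomputable def zetaEigenvalue (q s : ℝ) (p : Bool × ℕ) : ℝ :=
  if p.1 then q ^ (2 * (p.2 + 1)) else -(s ^ 2 * q ^ (2 * (p.2 + 1)))

/-- The eigenvalues of `F_n`. -/
noncomputable def FEigenvalue (q s : ℝ) (n : ℕ) (p : Bool × ℕ) : ℝ :=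
  ∏ k ∈ Finset.range n, (1 - q ^ (2 * (k : ℤ) - 2 * (n : ℤ)) * zetaEigenvalue q s p)

/-- The eigenvalues of `G_n`. -/
noncomputable def GEigenvalue (q s : ℝ) (n : ℕ) (p : Bool × ℕ) : ℝ :=
  ∏ k ∈ Finset.range n, (s ^ 2 + q ^ (2 * (k : ℤ) - 2 * (n : ℤ)) * zetaEigenvalue q s p)

section Eigenvalues

variable {q s : ℝ}

lemma zpow_mul_zetaEigenvalue_add (hq : q ≠ 0) (n k : ℕ) (p : Bool × ℕ) :
    q ^ (2 * (k : ℤ) - 2 * (n : ℤ)) * zetaEigenvalue q s (p.1, p.2 + n) =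
      q ^ (2 * k) * zetaEigenvalue q s p := by
  have h : q ^ (2 * (k : ℤ) - 2 * (n : ℤ)) * q ^ (2 * (p.2 + n + 1)) =
      q ^ (2 * k) * q ^ (2 * (p.2 + 1)) := by
    simp only [← zpow_natCast, ← zpow_add₀ hq]
    congr 1
    push_cast
    ring
  unfold zetaEigenvalue
  split_ifs
  · exact h
  · linear_combination (-s ^ 2) * h

lemma zpow_mul_pow_eq_one (hq : q ≠ 0) {n m : ℕ} (h : m < n) :
    q ^ (2 * ((n - 1 - m : ℕ) : ℤ) - 2 * (n : ℤ)) * q ^ (2 * (m + 1)) = 1 := by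
  rw [← zpow_natCast, ← zpow_add₀ hq, ← zpow_zero q]
  congr 1
  omega

lemma zpow_mul_pow_le_one (hq0 : 0 < q) (hq1 : q < 1) {n m : ℕ} (h : n ≤ m) (k : ℕ) :
    q ^ (2 * (k : ℤ) - 2 * (n : ℤ)) * q ^ (2 * (m + 1)) ≤ 1 := by
  rw [← zpow_natCast, ← zpow_add₀ hq0.ne', ← zpow_zero q]
  refine zpow_le_zpow_right_of_le_one₀ hq0 hq1.le ?_
  push_cast
  omega

lemma FEigenvalue_true_eq_zero (hq : q ≠ 0) {n m : ℕ} (h : m < n) :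
    FEigenvalue q s n (true, m) = 0 := by
  refine Finset.prod_eq_zero (i := n - 1 - m) (by simp; omega) ?_
  simp [zetaEigenvalue, zpow_mul_pow_eq_one hq h]

lemma GEigenvalue_false_eq_zero (hq : q ≠ 0) {n m : ℕ} (h : m < n) :
    GEigenvalue q s n (false, m) = 0 := by
  refine Finset.prod_eq_zero (i := n - 1 - m) (by simp; omega) ?_
  simp only [zetaEigenvalue, Bool.false_eq_true, if_false]
  linear_combination (-s ^ 2) * zpow_mul_pow_eq_one hq h

lemma one_le_FEigenvalue_false (hq0 : 0 < q) (n m : ℕ) :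
    1 ≤ FEigenvalue q s n (false, m) := by
  rw [← Finset.prod_const_one (s := Finset.range n)]
  refine Finset.prod_le_prod (fun _ _ => zero_le_one) fun k _ => ?_
  simp only [zetaEigenvalue, Bool.false_eq_true, if_false, mul_neg, sub_neg_eq_add]
  exact le_add_of_nonneg_right (by positivity)

lemma pow_le_GEigenvalue_true (hq0 : 0 < q) (n m : ℕ) :
    (s ^ 2) ^ n ≤ GEigenvalue q s n (true, m) := by
  have h := Finset.prod_le_prod (s := Finset.range n) (f := fun _ => s ^ 2)
    (g := fun k : ℕ => s ^ 2 + q ^ (2 * (k : ℤ) - 2 * (n : ℤ)) * zetaEigenvalue q s (true, m))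
    (fun _ _ => by positivity) (fun k _ => by
      simp only [zetaEigenvalue, if_true]
      exact le_add_of_nonneg_right (by positivity))
  simpa [GEigenvalue] using h

lemma FEigenvalue_nonneg (hq0 : 0 < q) (hq1 : q < 1) (n : ℕ) (p : Bool × ℕ) :
    0 ≤ FEigenvalue q s n p := by
  obtain ⟨_ | _, m⟩ := p
  · exact zero_le_one.trans (one_le_FEigenvalue_false hq0 n m)
  · rcases lt_or_ge m n with h | h
    · exact (FEigenvalue_true_eq_zero hq0.ne' h).ge
    · refine Finset.prod_nonneg fun k _ => ?_
      simpa [zetaEigenvalue] using zpow_mul_pow_le_one hq0 hq1 h k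

lemma GEigenvalue_nonneg (hq0 : 0 < q) (hq1 : q < 1) (n : ℕ) (p : Bool × ℕ) :
    0 ≤ GEigenvalue q s n p := by
  obtain ⟨_ | _, m⟩ := p
  · rcases lt_or_ge m n with h | h
    · exact (GEigenvalue_false_eq_zero hq0.ne' h).ge
    · refine Finset.prod_nonneg fun k _ => ?_
      simp only [zetaEigenvalue, Bool.false_eq_true, if_false]
      nlinarith [mul_le_mul_of_nonneg_left (zpow_mul_pow_le_one hq0 hq1 h k) (sq_nonneg s)]
  · exact (pow_nonneg (sq_nonneg s) n).trans (pow_le_GEigenvalue_true hq0 n m)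

lemma min_le_FEigenvalue_add_GEigenvalue (hq0 : 0 < q) (hq1 : q < 1) (n : ℕ) (p : Bool × ℕ) :
    min 1 ((s ^ 2) ^ n) ≤ FEigenvalue q s n p + GEigenvalue q s n p := by
  have hF := FEigenvalue_nonneg (s := s) hq0 hq1 n p
  have hG := GEigenvalue_nonneg (s := s) hq0 hq1 n p
  obtain ⟨_ | _, m⟩ := p
  · exact (min_le_left _ _).trans
      ((one_le_FEigenvalue_false hq0 n m).trans (le_add_of_nonneg_right hG))
  · exact (min_le_right _ _).trans
      ((pow_le_GEigenvalue_true hq0 n m).trans (le_add_of_nonneg_left hF))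

lemma FEigenvalue_mul_GEigenvalue_eq_zero (hq : q ≠ 0) {n m : ℕ} (h : m < n) (i : Bool) :
    FEigenvalue q s n (i, m) * GEigenvalue q s n (i, m) = 0 := by
  cases i
  · rw [GEigenvalue_false_eq_zero hq h, mul_zero]
  · rw [FEigenvalue_true_eq_zero hq h, zero_mul]

end Eigenvalues

/-- `H ⊕ H` (with `H = ℓ²(ℕ₀)`) is modelled by a complex Hilbert space `K` with a total
orthonormal family `e : Bool × ℕ → K`, where `e (false, ·)` spans the first (minus) copy and
`e (true, ·)` the second (plus) copy.  `ζ = Z₋ ⊕ Z₊` acts diagonally and `𝔖 = S ⊕ S` is the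
two-sided copy of the unilateral shift.  With `f_n(ζ), g_n(ζ), F_n, G_n` the indicated
products, square roots taken via the continuous functional calculus (`CFC.sqrt`) and
inverses via `Ring.inverse`, the 2×2 operator matrix `Q_n` is a self-adjoint idempotent. -/
theorem stmt4
    (q s : ℝ) (hq0 : 0 < q) (hq1 : q < 1) (hs : 0 < s)
    {K : Type*} [NormedAddCommGroup K] [InnerProductSpace ℂ K] [CompleteSpace K]
    (e : Bool × ℕ → K) (he : Orthonormal ℂ e)
    (htotal : (Submodule.span ℂ (Set.range e)).topologicalClosure = ⊤)
    (ζ 𝔖 : K →L[ℂ] K)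
    (hζm : ∀ m : ℕ, ζ (e (false, m)) = ((-(s ^ 2 * q ^ (2 * (m + 1))) : ℝ) : ℂ) • e (false, m))
    (hζp : ∀ m : ℕ, ζ (e (true, m)) = ((q ^ (2 * (m + 1)) : ℝ) : ℂ) • e (true, m))
    (h𝔖 : ∀ (i : Bool) (m : ℕ), 𝔖 (e (i, m)) = e (i, m + 1))
    (n : ℕ) (hn : 1 ≤ n)
    (fn gn Fn Gn : K →L[ℂ] K)
    (hfn : fn = ((List.range n).map fun k => 1 - ((q ^ (2 * k) : ℝ) : ℂ) • ζ).prod)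
    (hgn : gn = ((List.range n).map fun k => ((s ^ 2 : ℝ) : ℂ) • (1 : K →L[ℂ] K) + ((q ^ (2 * k) : ℝ) : ℂ) • ζ).prod)
    (hFn : Fn = ((List.range n).map fun k => 1 - ((q ^ (2 * (k : ℤ) - 2 * (n : ℤ)) : ℝ) : ℂ) • ζ).prod)
    (hGn : Gn = ((List.range n).map fun k => ((s ^ 2 : ℝ) : ℂ) • (1 : K →L[ℂ] K) + ((q ^ (2 * (k : ℤ) - 2 * (n : ℤ)) : ℝ) : ℂ) • ζ).prod)
    (Q : Matrix (Fin 2) (Fin 2) (K →L[ℂ] K))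
    (hQ : Q = !![Gn * Ring.inverse (Fn + Gn),
                 CFC.sqrt (Fn * Gn) * Ring.inverse (Fn + Gn) * 𝔖 ^ n;
                 CFC.sqrt (fn * gn) * Ring.inverse (fn + gn) * (star 𝔖) ^ n,
                 fn * Ring.inverse (fn + gn)]) :
    star Q = Q ∧ Q * Q = Q := by
  obtain ⟨b, hb⟩ : ∃ b : HilbertBasis (Bool × ℕ) ℂ K, ⇑b = e :=
    ⟨HilbertBasis.mk he htotal.ge, HilbertBasis.coe_mk he _⟩
  subst hb
  have hζ : IsDiag b ζ (zetaEigenvalue q s) := by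
    rintro ⟨_ | _, m⟩
    · simpa [zetaEigenvalue] using hζm m
    · simpa [zetaEigenvalue] using hζp m
  have hV : ∀ (k : ℕ) (i : Bool) (m : ℕ), (𝔖 ^ k) (b (i, m)) = b (i, m + k) := by
    intro k i
    induction k with
    | zero => simp
    | succ k ih =>
      intro m
      rw [pow_succ', mul_apply_eq_comp, ih, h𝔖, add_assoc]
  have hcast : (do let a ← List.range n; pure (a : ℤ)) = (List.range n).map Nat.cast :=
    List.map_eq_flatMap.symm
  rw [hcast, List.map_map] at hFn hGn
  set φ := FEigenvalue q s n
  set γ := GEigenvalue q s n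
  have hF : IsDiag b Fn φ := by
    rw [hFn]
    exact IsDiag.list_prod (fun k => IsDiag.one.sub (hζ.smul _)) n
  have hG : IsDiag b Gn γ := by
    rw [hGn]
    exact (IsDiag.list_prod (fun k => (IsDiag.one.smul _).add (hζ.smul _)) n).congr fun p => by
      simp [γ, GEigenvalue]
  have hf : IsDiag b fn (fun p => φ (p.1, p.2 + n)) := by
    rw [hfn]
    exact (IsDiag.list_prod (fun k => IsDiag.one.sub (hζ.smul _)) n).congr fun p => by
      simp [φ, FEigenvalue, zpow_mul_zetaEigenvalue_add hq0.ne']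
  have hg : IsDiag b gn (fun p => γ (p.1, p.2 + n)) := by
    rw [hgn]
    exact (IsDiag.list_prod (fun k => (IsDiag.one.smul _).add (hζ.smul _)) n).congr fun p => by
      simp [γ, GEigenvalue, zpow_mul_zetaEigenvalue_add hq0.ne']
  have hr : 0 < min 1 ((s ^ 2) ^ n) := lt_min one_pos (by positivity)
  have hle : ∀ p, min 1 ((s ^ 2) ^ n) ≤ φ p + γ p := min_le_FEigenvalue_add_GEigenvalue hq0 hq1 n
  have hne : ∀ p, φ p + γ p ≠ 0 := fun p => (hr.trans_le (hle p)).ne'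
  have hφγ : ∀ p, 0 ≤ φ p * γ p := fun p =>
    mul_nonneg (FEigenvalue_nonneg hq0 hq1 n p) (GEigenvalue_nonneg hq0 hq1 n p)
  have hJ := (hF.add hG).inverse ((hF.add hG).isUnit hr hle) hne
  have hj := (hf.add hg).inverse ((hf.add hg).isUnit hr fun p => hle _) fun p => hne _
  have hA := (hF.mul hG).sqrt hφγ
  have ha := (hf.mul hg).sqrt fun p => hφγ _
  rw [hQ, ← star_pow]
  refine shifted_diag_projection (hV n) (hG.mul hJ) (hA.mul hJ) (ha.mul hj)
    ((hf.mul hj).congr fun p => ?_) (fun p => ?_) fun i m h => ?_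
  · have := hne (p.1, p.2 + n)
    field_simp
    ring
  · have := hne p
    rw [mul_mul_mul_comm, Real.mul_self_sqrt (hφγ p)]
    field_simp
    ring
  · simp [φ, γ, FEigenvalue_mul_GEigenvalue_eq_zero hq0.ne' h]
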